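/- Let V be a finite set with a metric cost function c, let R ⊆ V be partitioned into nonempty pairwise disjoint clusters R₁, …, R_k, and let T be any clustered Steiner tree for this partition with local trees T₁, …, T_k. Then Σ_{i=1}^{k} mst(R_i) ≤ 2·c(T), where mst(R_i) is the minimum cost of a tree with vertex set exactly R_i (with mst(R_i) = 0 when |R_i| = 1). -/

import Mathlib

open scoped Classical

/-- The cost of a simple graph: the sum of the costs of its edges (for a
symmetric cost function, each unordered edge is counted once). -/
noncomputable def graphCost {α : Type*} [Fintype α] (c : α → α → ℝ) (G : SimpleGraph α) : ℝ :=
  (∑ x : α, ∑ y : α, if G.Adj x y then c x y else 0) / 2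

/-- A clustered Steiner tree for the clusters `P 0, …, P (k-1)`: a tree `tree`
on a vertex set `verts ⊆ V` containing all clusters, whose vertex set is
partitioned into parts `part i ⊇ P i`, each inducing a connected subgraph
(the local trees). -/
structure ClusteredSteinerTree {V : Type*} [Fintype V] {k : ℕ} (P : Fin k → Finset V) where
  verts : Finset V
  tree : SimpleGraph {x : V // x ∈ verts}
  isTree : tree.IsTree
  part : Fin k → Finset V
  part_subset : ∀ i, part i ⊆ verts
  cluster_subset : ∀ i, P i ⊆ part i
  part_cover : ∀ x ∈ verts, ∃ i, x ∈ part i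
  part_disjoint : ∀ i j, i ≠ j → Disjoint (part i) (part j)
  part_connected : ∀ i, (tree.induce {x : {x : V // x ∈ verts} | x.1 ∈ part i}).Connected

/-- The cost of a clustered Steiner tree: the sum of the costs of all of its
edges. -/
noncomputable def ClusteredSteinerTree.cost {V : Type*} [Fintype V] {k : ℕ}
    {P : Fin k → Finset V} (T : ClusteredSteinerTree P) (c : V → V → ℝ) : ℝ :=
  graphCost (fun a b => c a.1 b.1) T.tree

/-- `mstCost c R` is the minimum cost of a tree whose vertex set is exactly
`R` (it is `0` when `|R| = 1`). -/
noncomputable def mstCost {V : Type*} [Fintype V] (c : V → V → ℝ) (R : Finset V) : ℝ :=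
  sInf {x : ℝ | ∃ T : SimpleGraph {v : V // v ∈ R},
    T.IsTree ∧ graphCost (fun a b => c a.1 b.1) T = x}

/-- The cost of traversing the vertices of a list in order. -/
def listPathCost {α : Type*} (c : α → α → ℝ) : List α → ℝ
  | a :: b :: l => c a b + listPathCost c (b :: l)
  | _ => 0

theorem listPathCost_map {α β : Type*} (c : β → β → ℝ) (f : α → β) (l : List α) :
    listPathCost c (l.map f) = listPathCost (fun a b => c (f a) (f b)) l := by
  induction l with
  | nil => rfl
  | cons a l ih =>
    cases l with
    | nil => rfl
    | cons b l => simpa [listPathCost] using ih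

theorem listPathCost_le_cons {α : Type*} {c : α → α → ℝ} (hnn : ∀ u v, 0 ≤ c u v)
    (a : α) (l : List α) : listPathCost c l ≤ listPathCost c (a :: l) := by
  cases l with
  | nil => exact le_rfl
  | cons b l => simpa [listPathCost] using hnn a b

theorem listPathCost_cons_le_cons_cons {α : Type*} {c : α → α → ℝ} (hnn : ∀ u v, 0 ≤ c u v)
    (htri : ∀ u v w, c u w ≤ c u v + c v w) (a b : α) (l : List α) :
    listPathCost c (a :: l) ≤ listPathCost c (a :: b :: l) := by
  cases l with
  | nil => simpa [listPathCost] using hnn a b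
  | cons d l =>
    simp only [listPathCost]
    linarith [htri a b d]

theorem List.Sublist.listPathCost_le {α : Type*} {c : α → α → ℝ} (hnn : ∀ u v, 0 ≤ c u v)
    (htri : ∀ u v w, c u w ≤ c u v + c v w) {l₁ l₂ : List α} (h : l₁.Sublist l₂) :
    listPathCost c l₁ ≤ listPathCost c l₂ := by
  suffices listPathCost c l₁ ≤ listPathCost c l₂ ∧
      ∀ a, listPathCost c (a :: l₁) ≤ listPathCost c (a :: l₂) from this.1
  induction h with
  | slnil => exact ⟨le_rfl, fun _ => le_rfl⟩
  | cons b _ ih =>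
    exact ⟨ih.1.trans (listPathCost_le_cons hnn b _),
      fun a => (ih.2 a).trans (listPathCost_cons_le_cons_cons hnn htri a b _)⟩
  | cons_cons b _ ih =>
    refine ⟨ih.2 b, fun a => ?_⟩
    simpa [listPathCost] using ih.2 b

theorem listPathCost_insert_le {α : Type*} {c : α → α → ℝ} (hnn : ∀ u v, 0 ≤ c u v)
    (hsymm : ∀ u v, c u v = c v u) (htri : ∀ u v w, c u w ≤ c u v + c v w)
    (u v : α) (l₁ l₂ : List α) :
    listPathCost c (l₁ ++ u :: v :: l₂) ≤ listPathCost c (l₁ ++ u :: l₂) + 2 * c u v := by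
  induction l₁ with
  | nil =>
    cases l₂ with
    | nil => simpa [listPathCost] using by linarith [hnn u v]
    | cons d l =>
      simp only [List.nil_append, listPathCost]
      linarith [htri v u d, hsymm u v]
  | cons a l₁ ih =>
    cases l₁ with
    | nil => simpa [listPathCost, add_assoc] using ih
    | cons b l₁ => simpa [listPathCost, add_assoc] using ih

theorem graphCost_nonneg {α : Type*} [Fintype α] {c : α → α → ℝ} (hnn : ∀ u v, 0 ≤ c u v)
    (G : SimpleGraph α) : 0 ≤ graphCost c G := by
  unfold graphCost
  refine div_nonneg (Finset.sum_nonneg fun x _ => Finset.sum_nonneg fun y _ => ?_) zero_le_two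
  split_ifs
  exacts [hnn x y, le_rfl]

theorem graphCost_mono {α : Type*} [Fintype α] {c : α → α → ℝ} (hnn : ∀ u v, 0 ≤ c u v)
    {G H : SimpleGraph α} (h : G ≤ H) : graphCost c G ≤ graphCost c H := by
  unfold graphCost
  refine div_le_div_of_nonneg_right
    (Finset.sum_le_sum fun x _ => Finset.sum_le_sum fun y _ => ?_) zero_le_two
  split_ifs with h₁ h₂
  exacts [le_rfl, absurd (h h₁) h₂, hnn x y, le_rfl]

theorem graphCost_sup_edge_le {α : Type*} [Fintype α] {c : α → α → ℝ}
    (hnn : ∀ u v, 0 ≤ c u v) (hsymm : ∀ u v, c u v = c v u) (G : SimpleGraph α) (a b : α) :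
    graphCost c (G ⊔ SimpleGraph.edge a b) ≤ c a b + graphCost c G := by
  have e : ∀ a b : α, ∑ x, ∑ y, (if x = a then if y = b then c x y else 0 else 0) = c a b := by
    intro a b
    rw [Finset.sum_eq_single a (by simp +contextual) (by simp)]
    simp
  have key : 2 * graphCost c (G ⊔ SimpleGraph.edge a b) ≤
      2 * graphCost c G + (c a b + c b a) := by
    unfold graphCost
    rw [mul_div_cancel₀ _ two_ne_zero, mul_div_cancel₀ _ two_ne_zero, ← e a b, ← e b a]
    simp only [← Finset.sum_add_distrib]
    refine Finset.sum_le_sum fun x _ => Finset.sum_le_sum fun y _ => ?_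
    have := hnn x y
    simp only [SimpleGraph.sup_adj, SimpleGraph.edge_adj]
    split_ifs <;> first | linarith | (exfalso; tauto)
  linarith [hsymm a b]

/-- The vertices of a list are connected by a graph costing at most as much as traversing it. -/
theorem exists_graphCost_le_listPathCost {α : Type*} [Fintype α] {c : α → α → ℝ}
    (hnn : ∀ u v, 0 ≤ c u v) (hsymm : ∀ u v, c u v = c v u) (l : List α) :
    ∃ H : SimpleGraph α, (∀ x ∈ l, ∀ y ∈ l, H.Reachable x y) ∧
      graphCost c H ≤ listPathCost c l := by
  induction l with
  | nil => exact ⟨⊥, by simp, by simp [graphCost, listPathCost]⟩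
  | cons a l ih =>
    cases l with
    | nil => exact ⟨⊥, by simp, by simp [graphCost, listPathCost]⟩
    | cons b l =>
      obtain ⟨H, hr, hc⟩ := ih
      have hab : (H ⊔ SimpleGraph.edge a b).Reachable a b := by
        rcases eq_or_ne a b with rfl | hne
        · rfl
        · exact SimpleGraph.Adj.reachable (by simp [SimpleGraph.edge_adj, hne])
      have hb : ∀ x ∈ a :: b :: l, (H ⊔ SimpleGraph.edge a b).Reachable x b := by
        intro x hx
        rcases List.mem_cons.1 hx with rfl | hx
        · exact hab
        · exact (hr x hx b (by simp)).mono le_sup_left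
      refine ⟨_, fun x hx y hy => (hb x hx).trans (hb y hy).symm, ?_⟩
      have := graphCost_sup_edge_le hnn hsymm H a b
      simp only [listPathCost]
      linarith

theorem mstCost_le_listPathCost {V : Type*} [Fintype V] {c : V → V → ℝ}
    (hnn : ∀ u v, 0 ≤ c u v) (hsymm : ∀ u v, c u v = c v u)
    {R : Finset V} (hR : R.Nonempty) {l : List V} (hl : ∀ x, x ∈ l ↔ x ∈ R) :
    mstCost c R ≤ listPathCost c l := by
  lift l to List {v : V // v ∈ R} using fun x hx => (hl x).1 hx
  obtain ⟨H, hr, hc⟩ := exists_graphCost_le_listPathCost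
    (c := fun a b : {v : V // v ∈ R} => c a.1 b.1) (fun _ _ => hnn _ _) (fun _ _ => hsymm _ _) l
  have hmem : ∀ x, x ∈ l := fun x => by simpa using (hl x.1).2 x.2
  have : Nonempty {v : V // v ∈ R} := hR.to_subtype
  have hconn : H.Connected := ⟨fun x y => hr x (hmem x) y (hmem y)⟩
  obtain ⟨T, hTH, hT⟩ := hconn.exists_isTree_le
  rw [listPathCost_map]
  refine le_trans (csInf_le ⟨0, ?_⟩ ⟨T, hT, rfl⟩)
    ((graphCost_mono (fun _ _ => hnn _ _) hTH).trans hc)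
  rintro _ ⟨T', -, rfl⟩
  exact graphCost_nonneg (fun _ _ => hnn _ _) T'

/-- A connected graph has a traversal of all its vertices costing at most twice the graph. -/
theorem SimpleGraph.Connected.exists_listPathCost_le {α : Type*} [Fintype α]
    {c : α → α → ℝ} (hnn : ∀ u v, 0 ≤ c u v) (hsymm : ∀ u v, c u v = c v u)
    (htri : ∀ u v w, c u w ≤ c u v + c v w) {G : SimpleGraph α} (hG : G.Connected) :
    ∃ l : List α, (∀ x, x ∈ l) ∧ listPathCost c l ≤ 2 * graphCost c G := by
  induction hn : Fintype.card α using Nat.strong_induction_on generalizing α with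
  | _ n ih =>
  rcases subsingleton_or_nontrivial α with hs | hs
  · obtain ⟨a⟩ := hG.nonempty
    refine ⟨[a], fun x => by simp [Subsingleton.elim x a], ?_⟩
    simpa [listPathCost] using graphCost_nonneg hnn G
  · obtain ⟨v, hv⟩ := hG.exists_connected_induce_compl_singleton_of_finite_nontrivial
    obtain ⟨u, hu⟩ := hG.preconnected.exists_adj_of_nontrivial v
    have hcard : Fintype.card ({v}ᶜ : Set α) < n :=
      hn ▸ Fintype.card_subtype_lt (x := v) (by simp)
    obtain ⟨l, hl, hlc⟩ := ih _ hcard (c := fun a b => c a.1 b.1) (fun _ _ => hnn _ _)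
      (fun _ _ => hsymm _ _) (fun _ _ _ => htri _ _ _) hv rfl
    have hmem : ∀ x, x ≠ v → x ∈ l.map Subtype.val :=
      fun x hx => List.mem_map.2 ⟨⟨x, hx⟩, hl _, rfl⟩
    obtain ⟨l₁, l₂, h₁₂⟩ := List.append_of_mem (hmem u hu.ne')
    refine ⟨l₁ ++ u :: v :: l₂, fun x => ?_, ?_⟩
    · rcases eq_or_ne x v with rfl | hx
      · simp
      · have := hmem x hx
        rw [h₁₂] at this
        simp only [List.mem_append, List.mem_cons] at this ⊢
        tauto
    refine (listPathCost_insert_le hnn hsymm htri u v l₁ l₂).trans ?_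
    rw [← h₁₂, listPathCost_map]
    refine (add_le_add_left hlc _).trans ?_
    set f : α → α → ℝ := fun x y => if G.Adj x y then c x y else 0 with hf
    have hf0 : ∀ x y, 0 ≤ f x y := fun x y => by
      simp only [hf]
      split_ifs
      exacts [hnn x y, le_rfl]
    have hsplit : ∑ x, ∑ y, f x y = ∑ y, f v y + (∑ x : {x // x ≠ v}, f x v +
        ∑ x : {x // x ≠ v}, ∑ y : {y // y ≠ v}, f x y) := by
      rw [Fintype.sum_eq_add_sum_subtype_ne (fun x => ∑ y, f x y) v, ← Finset.sum_add_distrib]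
      congr 1
      exact Finset.sum_congr rfl fun x _ => Fintype.sum_eq_add_sum_subtype_ne _ v
    have hsub : 2 * graphCost (fun a b : ({v}ᶜ : Set α) => c a.1 b.1) (G.induce {v}ᶜ) =
        ∑ x : {x // x ≠ v}, ∑ y : {y // y ≠ v}, f x y := by
      unfold graphCost
      rw [mul_div_cancel₀ _ two_ne_zero]
      rfl
    have h₁ : f v u ≤ ∑ y, f v y :=
      Finset.single_le_sum (f := fun y => f v y) (fun y _ => hf0 v y) (Finset.mem_univ u)
    have h₂ : f u v ≤ ∑ x : {x // x ≠ v}, f x v :=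
      Finset.single_le_sum (f := fun x : {x // x ≠ v} => f x v) (fun x _ => hf0 x v)
        (Finset.mem_univ ⟨u, hu.ne'⟩)
    have hG2 : 2 * graphCost c G = ∑ x, ∑ y, f x y := by
      unfold graphCost
      rw [mul_div_cancel₀ _ two_ne_zero]
    simp only [hf, hu, hu.symm, if_true] at h₁ h₂
    rw [hsub, hG2, hsplit]
    linarith [hsymm u v]

/-- Disjoint vertex sets induce subgraphs of total cost at most that of the whole graph. -/
theorem sum_graphCost_induce_le {α ι : Type*} [Fintype α] [Fintype ι] {c : α → α → ℝ}
    (hnn : ∀ u v, 0 ≤ c u v) (G : SimpleGraph α) (s : ι → Set α)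
    (hs : Pairwise fun i j => Disjoint (s i) (s j)) :
    ∑ i, graphCost (fun a b : s i => c a b) (G.induce (s i)) ≤ graphCost c G := by
  set f : α → α → ℝ := fun x y => if G.Adj x y then c x y else 0 with hf
  have hf0 : ∀ x y, 0 ≤ f x y := fun x y => by
    simp only [hf]
    split_ifs
    exacts [hnn x y, le_rfl]
  unfold graphCost
  rw [← Finset.sum_div]
  refine div_le_div_of_nonneg_right ?_ zero_le_two
  calc ∑ i, ∑ x : s i, ∑ y : s i, f x y
      ≤ ∑ i, ∑ x : s i, ∑ y, f x y := by
        refine Finset.sum_le_sum fun i _ => Finset.sum_le_sum fun x _ => ?_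
        rw [Finset.sum_set_coe (f := fun y => f x y)]
        exact Finset.sum_le_univ_sum_of_nonneg fun y => hf0 x y
    _ = ∑ i, ∑ x ∈ (s i).toFinset, ∑ y, f x y :=
        Finset.sum_congr rfl fun i _ => Finset.sum_set_coe (f := fun x => ∑ y, f x y) (s i)
    _ = ∑ x ∈ Finset.univ.biUnion fun i => (s i).toFinset, ∑ y, f x y :=
        (Finset.sum_biUnion fun i _ j _ hij => Set.disjoint_toFinset.2 (hs hij)).symm
    _ ≤ ∑ x, ∑ y, f x y :=
        Finset.sum_le_univ_sum_of_nonneg fun x => Finset.sum_nonneg fun y _ => hf0 x y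

/-- For any clustered Steiner tree `T` for nonempty pairwise disjoint
clusters `P 1, …, P k`, the sum of the minimum spanning tree costs of the
clusters is at most `2 · c(T)`. -/
theorem sum_mst_le_two_clustered {V : Type*} [Fintype V] [DecidableEq V]
    (c : V → V → ℝ)
    (hnn : ∀ u v, 0 ≤ c u v) (hsymm : ∀ u v, c u v = c v u)
    (hrefl : ∀ v, c v v = 0) (htri : ∀ u v w, c u w ≤ c u v + c v w)
    {k : ℕ} (P : Fin k → Finset V)
    (hne : ∀ i, (P i).Nonempty)
    (hdisj : ∀ i j, i ≠ j → Disjoint (P i) (P j))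
    (T : ClusteredSteinerTree P) :
    ∑ i : Fin k, mstCost c (P i) ≤ 2 * T.cost c := by
  let s : Fin k → Set {x : V // x ∈ T.verts} := fun i => {x | x.1 ∈ T.part i}
  have hs : Pairwise fun i j => Disjoint (s i) (s j) := fun i j hij =>
    Set.disjoint_left.2 fun x hi hj => Finset.disjoint_left.1 (T.part_disjoint i j hij) hi hj
  have hconn : ∀ i, (T.tree.induce (s i)).Connected := T.part_connected
  have hmem : ∀ i, ∀ x ∈ P i, ∃ y : s i, y.1.1 = x := fun i x hx =>
    have hxi := T.cluster_subset i hx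
    ⟨⟨⟨x, T.part_subset i hxi⟩, hxi⟩, rfl⟩
  clear_value s
  have hpart : ∀ i, mstCost c (P i) ≤
      2 * graphCost (fun a b : s i => c a.1.1 b.1.1) (T.tree.induce (s i)) := by
    intro i
    obtain ⟨l, hl, hlc⟩ := (hconn i).exists_listPathCost_le
      (c := fun a b : s i => c a.1.1 b.1.1) (fun _ _ => hnn _ _) (fun _ _ => hsymm _ _)
      (fun _ _ _ => htri _ _ _)
    rw [← listPathCost_map c (fun a : s i => a.1.1)] at hlc
    refine le_trans (mstCost_le_listPathCost hnn hsymm (hne i) fun x => ?_)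
      ((List.filter_sublist (p := fun x => decide (x ∈ P i))).listPathCost_le hnn htri |>.trans hlc)
    simp only [List.mem_filter, decide_eq_true_eq, and_iff_right_iff_imp]
    intro hx
    obtain ⟨y, hy⟩ := hmem i x hx
    exact List.mem_map.2 ⟨y, hl y, hy⟩
  calc ∑ i, mstCost c (P i)
      ≤ ∑ i, 2 * graphCost (fun a b : s i => c a.1.1 b.1.1) (T.tree.induce (s i)) :=
        Finset.sum_le_sum fun i _ => hpart i
    _ = 2 * ∑ i, graphCost (fun a b : s i => c a.1.1 b.1.1) (T.tree.induce (s i)) :=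
        (Finset.mul_sum ..).symm
    _ ≤ 2 * T.cost c :=
        mul_le_mul_of_nonneg_left (sum_graphCost_induce_le
          (c := fun a b : {x // x ∈ T.verts} => c a.1 b.1) (fun _ _ => hnn _ _) T.tree s hs)
          zero_le_two
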